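/- The bracket {·,·} makes the sequence of spaces ℤS_n into a twisted Lie algebra: for all x ∈ ℤS_n, y ∈ ℤS_m and z ∈ ℤS_p, (a) {y,x} = −{x,y}·Z_{m,n} (antisymmetry), and (b) {x,{y,z}} + {y,{z,x}}·Z_{n,m+p} + {z,{x,y}}·Z_{n+m,p} = 0 (twisted Jacobi identity). -/

import Mathlib

open Equiv

/-- The one-line value (0-indexed) of a permutation of `Fin N`, extended to all of `ℕ`
by the identity.  Position `j` (0-indexed) carries the value `pv σ j` (0-indexed). -/
def pv {N : ℕ} (σ : Equiv.Perm (Fin N)) (j : ℕ) : ℕ :=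
  if h : j < N then (σ ⟨j, h⟩ : ℕ) else j

/-- The left weak (Bruhat) order on `S_N`: inclusion of inversion sets, where the
inversion set of `σ` is `{(p,q) | p < q ∧ σ p > σ q}`. -/
def wle {N : ℕ} (σ τ : Equiv.Perm (Fin N)) : Prop :=
  ∀ p q : Fin N, p < q → σ q < σ p → τ q < τ p

instance {N : ℕ} (σ τ : Equiv.Perm (Fin N)) : Decidable (wle σ τ) :=
  inferInstanceAs (Decidable (∀ p q : Fin N, p < q → σ q < σ p → τ q < τ p))

/-- The `a`-values of the insertion construction `B_i` (0-indexed values):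
`avv m s x = x` if `x < s` and `x + m - 1` otherwise. -/
def avv (m s x : ℕ) : ℕ := if x < s then x else x + m - 1

/-- The one-line values of the permutation `B_i(σ,τ) ∈ S_{n+m-1}`
(0-indexed position `i`, with `i < n`, and 0-indexed values). -/
def BFun {n m : ℕ} (i : ℕ) (σ : Equiv.Perm (Fin n)) (τ : Equiv.Perm (Fin m)) (j : ℕ) : ℕ :=
  if j < i then avv m (pv σ i) (pv σ j)
  else if j < i + m then pv τ (j - i) + pv σ i
  else avv m (pv σ i) (pv σ (j - m + 1))

/-- `ρ ∈ S_{n+m-1}` is the permutation `B_i(σ,τ)`. -/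
def IsB {n m : ℕ} (i : ℕ) (σ : Equiv.Perm (Fin n)) (τ : Equiv.Perm (Fin m))
    (ρ : Equiv.Perm (Fin (n + m - 1))) : Prop :=
  ∀ j : ℕ, j < n + m - 1 → pv ρ j = BFun i σ τ j

/-- The permutation `σ/τ ∈ S_{n+m}`: `(σ_1,…,σ_n, τ_1+n,…,τ_m+n)` in one-line notation. -/
def slashP {n m : ℕ} (σ : Equiv.Perm (Fin n)) (τ : Equiv.Perm (Fin m)) :
    Equiv.Perm (Fin (n + m)) :=
  finSumFinEquiv.permCongr (Equiv.sumCongr σ τ)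

/-- The permutation `Z_{n,m} = (m+1, m+2, …, m+n, 1, 2, …, m) ∈ S_{n+m}`. -/
def zperm (n m : ℕ) : Equiv.Perm (Fin (n + m)) :=
  finSumFinEquiv.symm.trans ((Equiv.sumComm (Fin n) (Fin m)).trans
    (finSumFinEquiv.trans (finCongr (Nat.add_comm m n))))

/-- The permutation `σ\τ ∈ S_{n+m}`: `(σ_1+m,…,σ_n+m, τ_1,…,τ_m)` in one-line notation.
It equals `Z_{n,m} ∘ (σ/τ)`. -/
def backslashP {n m : ℕ} (σ : Equiv.Perm (Fin n)) (τ : Equiv.Perm (Fin m)) :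
    Equiv.Perm (Fin (n + m)) :=
  zperm n m * slashP σ τ

/-- The twisted Lie bracket `{·,·} : ℤS_n × ℤS_m → ℤS_{n+m}`, the bilinear map determined
by `{F_σ, F_τ} = F_{σ/τ} - F_{σ\τ}`. -/
noncomputable def brk {n m : ℕ} (x : Equiv.Perm (Fin n) →₀ ℤ) (y : Equiv.Perm (Fin m) →₀ ℤ) :
    Equiv.Perm (Fin (n + m)) →₀ ℤ :=
  x.sum fun σ c => y.sum fun τ d =>
    (c * d) • (Finsupp.single (slashP σ τ) (1 : ℤ) - Finsupp.single (backslashP σ τ) (1 : ℤ))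

/-- Transport of a permutation along an equality of sizes. -/
def pcast {a b : ℕ} (h : a = b) (ρ : Equiv.Perm (Fin a)) : Equiv.Perm (Fin b) :=
  (finCongr h).permCongr ρ

/-- Transport of an element of `ℤS_a` along an equality `a = b`. -/
noncomputable def fcast {a b : ℕ} (h : a = b) (x : Equiv.Perm (Fin a) →₀ ℤ) :
    Equiv.Perm (Fin b) →₀ ℤ :=
  Finsupp.mapDomain (pcast h) x

/-- The right action of `S_N` on `ℤS_N`: `(Σ c_ρ F_ρ)·π = Σ c_ρ F_{ρ∘π}`, where
`ρ∘π = ρ * π` is the composite `i ↦ ρ(π(i))`. -/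
noncomputable def ract {N : ℕ} (x : Equiv.Perm (Fin N) →₀ ℤ) (π : Equiv.Perm (Fin N)) :
    Equiv.Perm (Fin N) →₀ ℤ :=
  Finsupp.mapDomain (fun ρ => ρ * π) x

/-! ### One-line values -/

theorem pv_lt {N : ℕ} (σ : Equiv.Perm (Fin N)) {j : ℕ} (h : j < N) : pv σ j < N := by
  simp [pv, h]

theorem pv_val {N : ℕ} (σ : Equiv.Perm (Fin N)) (i : Fin N) : pv σ i = σ i := by
  simp [pv]

theorem pv_of_le {N : ℕ} (σ : Equiv.Perm (Fin N)) {j : ℕ} (h : N ≤ j) : pv σ j = j := by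
  simp [pv, Nat.not_lt.mpr h]

theorem pv_injective {N : ℕ} : Function.Injective (pv : Equiv.Perm (Fin N) → ℕ → ℕ) := by
  intro σ τ h
  ext j
  simpa [pv] using congrFun h j

theorem pv_mul {N : ℕ} (σ τ : Equiv.Perm (Fin N)) (j : ℕ) :
    pv (σ * τ) j = pv σ (pv τ j) := by
  by_cases h : j < N <;> simp [pv, h]

theorem pv_pcast {a b : ℕ} (h : a = b) (σ : Equiv.Perm (Fin a)) (j : ℕ) :
    pv (pcast h σ) j = pv σ j := by
  subst h
  simp [pcast, pv]

theorem pv_slashP {n m : ℕ} (σ : Equiv.Perm (Fin n)) (τ : Equiv.Perm (Fin m)) (j : ℕ) :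
    pv (slashP σ τ) j = if j < n then pv σ j else pv τ (j - n) + n := by
  rcases lt_or_ge j (n + m) with h | h
  · obtain ⟨i, rfl⟩ : ∃ i : Fin (n + m), (i : ℕ) = j := ⟨⟨j, h⟩, rfl⟩
    induction i using Fin.addCases with
    | left i => rw [pv_val]; simp [pv_val, slashP, Equiv.permCongr_apply]
    | right i => rw [pv_val]; simp [pv_val, slashP, Equiv.permCongr_apply, Nat.add_comm]
  · rw [pv_of_le _ h, if_neg (by omega), pv_of_le _ (by omega)]
    omega

theorem pv_zperm (n m j : ℕ) :
    pv (zperm n m) j = if j < n then j + m else if j < n + m then j - n else j := by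
  rcases lt_or_ge j (n + m) with h | h
  · obtain ⟨i, rfl⟩ : ∃ i : Fin (n + m), (i : ℕ) = j := ⟨⟨j, h⟩, rfl⟩
    induction i using Fin.addCases with
    | left i => rw [pv_val]; simp [zperm, Nat.add_comm]
    | right i => rw [pv_val]; simp [zperm]
  · rw [pv_of_le _ h, if_neg (by omega), if_neg (by omega)]

theorem pv_backslashP {n m : ℕ} (σ : Equiv.Perm (Fin n)) (τ : Equiv.Perm (Fin m)) (j : ℕ) :
    pv (backslashP σ τ) j =
      if j < n then pv σ j + m else if j < n + m then pv τ (j - n) else j := by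
  rw [backslashP, pv_mul, pv_slashP, pv_zperm]
  have h₁ := @pv_lt n σ j
  have h₂ := @pv_lt m τ (j - n)
  have h₃ := @pv_of_le m τ (j - n)
  grind

/-! ### Linearity -/

theorem brk_add_left {n m : ℕ} (x x' : Equiv.Perm (Fin n) →₀ ℤ) (y : Equiv.Perm (Fin m) →₀ ℤ) :
    brk (x + x') y = brk x y + brk x' y := by
  unfold brk
  refine Finsupp.sum_add_index' (by simp) fun σ c c' => ?_
  simp only [add_mul, add_smul, Finsupp.sum_add]

theorem brk_add_right {n m : ℕ} (x : Equiv.Perm (Fin n) →₀ ℤ) (y y' : Equiv.Perm (Fin m) →₀ ℤ) :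
    brk x (y + y') = brk x y + brk x y' := by
  unfold brk
  rw [← Finsupp.sum_add]
  refine Finsupp.sum_congr fun σ _ => Finsupp.sum_add_index' (by simp) fun τ d d' => ?_
  rw [mul_add, add_smul]

theorem brk_zero_left {n m : ℕ} (y : Equiv.Perm (Fin m) →₀ ℤ) :
    brk (0 : Equiv.Perm (Fin n) →₀ ℤ) y = 0 := by
  simp [brk]

theorem brk_zero_right {n m : ℕ} (x : Equiv.Perm (Fin n) →₀ ℤ) :
    brk x (0 : Equiv.Perm (Fin m) →₀ ℤ) = 0 := by
  simp [brk]

theorem brk_sub_right {n m : ℕ} (x : Equiv.Perm (Fin n) →₀ ℤ) (y y' : Equiv.Perm (Fin m) →₀ ℤ) :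
    brk x (y - y') = brk x y - brk x y' := by
  rw [eq_sub_iff_add_eq, ← brk_add_right, sub_add_cancel]

theorem brk_single {n m : ℕ} (σ : Equiv.Perm (Fin n)) (τ : Equiv.Perm (Fin m)) (c d : ℤ) :
    brk (Finsupp.single σ c) (Finsupp.single τ d) =
      Finsupp.single (slashP σ τ) (c * d) - Finsupp.single (backslashP σ τ) (c * d) := by
  simp [brk, smul_sub]

theorem ract_zero {N : ℕ} (π : Equiv.Perm (Fin N)) : ract 0 π = 0 :=
  Finsupp.mapDomain_zero

theorem ract_add {N : ℕ} (x y : Equiv.Perm (Fin N) →₀ ℤ) (π : Equiv.Perm (Fin N)) :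
    ract (x + y) π = ract x π + ract y π :=
  Finsupp.mapDomain_add

theorem ract_sub {N : ℕ} (x y : Equiv.Perm (Fin N) →₀ ℤ) (π : Equiv.Perm (Fin N)) :
    ract (x - y) π = ract x π - ract y π := by
  rw [eq_sub_iff_add_eq, ← ract_add, sub_add_cancel]

theorem ract_single {N : ℕ} (ρ π : Equiv.Perm (Fin N)) (c : ℤ) :
    ract (Finsupp.single ρ c) π = Finsupp.single (ρ * π) c :=
  Finsupp.mapDomain_single

theorem fcast_zero {a b : ℕ} (h : a = b) : fcast h 0 = 0 :=
  Finsupp.mapDomain_zero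

theorem fcast_add {a b : ℕ} (h : a = b) (x y : Equiv.Perm (Fin a) →₀ ℤ) :
    fcast h (x + y) = fcast h x + fcast h y :=
  Finsupp.mapDomain_add

theorem fcast_sub {a b : ℕ} (h : a = b) (x y : Equiv.Perm (Fin a) →₀ ℤ) :
    fcast h (x - y) = fcast h x - fcast h y := by
  rw [eq_sub_iff_add_eq, ← fcast_add, sub_add_cancel]

theorem fcast_single {a b : ℕ} (h : a = b) (ρ : Equiv.Perm (Fin a)) (c : ℤ) :
    fcast h (Finsupp.single ρ c) = Finsupp.single (pcast h ρ) c :=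
  Finsupp.mapDomain_single

/-! ### Rotating blocks -/

theorem pcast_slashP_mul_zperm {n m : ℕ} (h : n + m = m + n)
    (σ : Equiv.Perm (Fin n)) (τ : Equiv.Perm (Fin m)) :
    pcast h (slashP σ τ) * zperm m n = backslashP τ σ := by
  refine pv_injective (funext fun j => ?_)
  simp only [pv_mul, pv_pcast, pv_slashP, pv_zperm, pv_backslashP]
  have := @pv_of_le m τ (j - n)
  grind

theorem pcast_backslashP_mul_zperm {n m : ℕ} (h : n + m = m + n)
    (σ : Equiv.Perm (Fin n)) (τ : Equiv.Perm (Fin m)) :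
    pcast h (backslashP σ τ) * zperm m n = slashP τ σ := by
  refine pv_injective (funext fun j => ?_)
  simp only [pv_mul, pv_pcast, pv_slashP, pv_zperm, pv_backslashP]
  have := @pv_of_le n σ (j - m)
  grind

theorem brk_antisymm {n m : ℕ} (h : n + m = m + n)
    (x : Equiv.Perm (Fin n) →₀ ℤ) (y : Equiv.Perm (Fin m) →₀ ℤ) :
    brk y x = - ract (fcast h (brk x y)) (zperm m n) := by
  induction x using Finsupp.induction_linear with
  | zero => simp [brk_zero_left, brk_zero_right, fcast_zero, ract_zero]
  | add x x' hx hx' =>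
    rw [brk_add_left, brk_add_right, fcast_add, ract_add, hx, hx', neg_add]
  | single σ c =>
    induction y using Finsupp.induction_linear with
    | zero => simp [brk_zero_left, brk_zero_right, fcast_zero, ract_zero]
    | add y y' hy hy' =>
      rw [brk_add_left, brk_add_right, fcast_add, ract_add, hy, hy', neg_add]
    | single τ d =>
      rw [brk_single, brk_single, fcast_sub, ract_sub, fcast_single, fcast_single, ract_single,
        ract_single, pcast_slashP_mul_zperm, pcast_backslashP_mul_zperm, mul_comm d c, neg_sub]

theorem ext_of_blocks {n m p : ℕ} {π π' : Equiv.Perm (Fin (n + m + p))}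
    (h₁ : ∀ j < n, pv π j = pv π' j) (h₂ : ∀ j < m, pv π (n + j) = pv π' (n + j))
    (h₃ : ∀ j < p, pv π (n + m + j) = pv π' (n + m + j)) : π = π' := by
  refine pv_injective (funext fun j => ?_)
  rcases lt_or_ge j n with h | h
  · exact h₁ j h
  rcases lt_or_ge j (n + m) with h' | h'
  · simpa [Nat.add_sub_cancel' h] using h₂ (j - n) (by omega)
  rcases lt_or_ge j (n + m + p) with h'' | h''
  · simpa [Nat.add_sub_cancel' h'] using h₃ (j - (n + m)) (by omega)
  · rw [pv_of_le _ h'', pv_of_le _ h'']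

/-! The six orders in which the values of three blocks can be stacked: each arises from two
of the three terms of the Jacobi identity. Subscripts list the blocks by increasing values. -/

section Jacobi

variable {n m p : ℕ} (σ : Equiv.Perm (Fin n)) (τ : Equiv.Perm (Fin m)) (ρ : Equiv.Perm (Fin p))
  (h₁ : n + (m + p) = n + m + p) (h₂ : m + (p + n) = n + (m + p)) (h₃ : p + (n + m) = n + m + p)

theorem slash_order_₁₃₂ :
    pcast h₁ (pcast h₂ (backslashP τ (backslashP ρ σ)) * zperm n (m + p)) =
      pcast h₁ (slashP σ (backslashP τ ρ)) := by
  refine ext_of_blocks (fun j h => ?_) (fun j h => ?_) (fun j h => ?_) <;>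
    simp only [pv_mul, pv_pcast, pv_slashP, pv_zperm, pv_backslashP]
  · have := pv_lt σ h
    grind
  · have := pv_lt τ h
    grind
  · have := pv_lt ρ h
    grind

theorem slash_order_₂₃₁ :
    pcast h₁ (pcast h₂ (slashP τ (slashP ρ σ)) * zperm n (m + p)) =
      pcast h₁ (backslashP σ (slashP τ ρ)) := by
  refine ext_of_blocks (fun j h => ?_) (fun j h => ?_) (fun j h => ?_) <;>
    simp only [pv_mul, pv_pcast, pv_slashP, pv_zperm, pv_backslashP]
  · have := pv_lt σ h
    grind
  · have := pv_lt τ h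
    grind
  · have := pv_lt ρ h
    grind

theorem slash_order_₂₁₃ :
    pcast h₃ (backslashP ρ (backslashP σ τ)) * zperm (n + m) p =
      pcast h₁ (pcast h₂ (slashP τ (backslashP ρ σ)) * zperm n (m + p)) := by
  refine ext_of_blocks (fun j h => ?_) (fun j h => ?_) (fun j h => ?_) <;>
    simp only [pv_mul, pv_pcast, pv_slashP, pv_zperm, pv_backslashP]
  · have := pv_lt σ h
    grind
  · have := pv_lt τ h
    grind
  · have := pv_lt ρ h
    grind

theorem slash_order_₃₁₂ :
    pcast h₃ (slashP ρ (slashP σ τ)) * zperm (n + m) p =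
      pcast h₁ (pcast h₂ (backslashP τ (slashP ρ σ)) * zperm n (m + p)) := by
  refine ext_of_blocks (fun j h => ?_) (fun j h => ?_) (fun j h => ?_) <;>
    simp only [pv_mul, pv_pcast, pv_slashP, pv_zperm, pv_backslashP]
  · have := pv_lt σ h
    grind
  · have := pv_lt τ h
    grind
  · have := pv_lt ρ h
    grind

theorem slash_order_₃₂₁ :
    pcast h₃ (slashP ρ (backslashP σ τ)) * zperm (n + m) p =
      pcast h₁ (backslashP σ (backslashP τ ρ)) := by
  refine ext_of_blocks (fun j h => ?_) (fun j h => ?_) (fun j h => ?_) <;>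
    simp only [pv_mul, pv_pcast, pv_slashP, pv_zperm, pv_backslashP]
  · have := pv_lt σ h
    grind
  · have := pv_lt τ h
    grind
  · have := pv_lt ρ h
    grind

theorem slash_order_₁₂₃ :
    pcast h₃ (backslashP ρ (slashP σ τ)) * zperm (n + m) p =
      pcast h₁ (slashP σ (slashP τ ρ)) := by
  refine ext_of_blocks (fun j h => ?_) (fun j h => ?_) (fun j h => ?_) <;>
    simp only [pv_mul, pv_pcast, pv_slashP, pv_zperm, pv_backslashP]
  · have := pv_lt σ h
    grind
  · have := pv_lt τ h
    grind
  · have := pv_lt ρ h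
    grind

theorem brk_jacobi (x : Equiv.Perm (Fin n) →₀ ℤ) (y : Equiv.Perm (Fin m) →₀ ℤ)
    (z : Equiv.Perm (Fin p) →₀ ℤ) :
    fcast h₁ (brk x (brk y z))
      + fcast h₁ (ract (fcast h₂ (brk y (brk z x))) (zperm n (m + p)))
      + ract (fcast h₃ (brk z (brk x y))) (zperm (n + m) p) = 0 := by
  induction x using Finsupp.induction_linear with
  | zero => simp [brk_zero_left, brk_zero_right, fcast_zero, ract_zero]
  | add x x' hx hx' =>
    simp only [brk_add_left, brk_add_right, fcast_add, ract_add]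
    rw [← add_zero (0 : Equiv.Perm (Fin (n + m + p)) →₀ ℤ)]
    nth_rewrite 1 [← hx]
    rw [← hx']
    abel
  | single σ a =>
  induction y using Finsupp.induction_linear with
  | zero => simp [brk_zero_left, brk_zero_right, fcast_zero, ract_zero]
  | add y y' hy hy' =>
    simp only [brk_add_left, brk_add_right, fcast_add, ract_add]
    rw [← add_zero (0 : Equiv.Perm (Fin (n + m + p)) →₀ ℤ)]
    nth_rewrite 1 [← hy]
    rw [← hy']
    abel
  | single τ b =>
  induction z using Finsupp.induction_linear with
  | zero => simp [brk_zero_left, brk_zero_right, fcast_zero, ract_zero]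
  | add z z' hz hz' =>
    simp only [brk_add_left, brk_add_right, fcast_add, ract_add]
    rw [← add_zero (0 : Equiv.Perm (Fin (n + m + p)) →₀ ℤ)]
    nth_rewrite 1 [← hz]
    rw [← hz']
    abel
  | single ρ c =>
    simp only [brk_single, brk_sub_right, fcast_sub, fcast_single, ract_sub, ract_single,
      slash_order_₁₃₂ σ τ ρ h₁ h₂, slash_order_₂₃₁ σ τ ρ h₁ h₂,
      slash_order_₂₁₃ σ τ ρ h₁ h₂ h₃, slash_order_₃₁₂ σ τ ρ h₁ h₂ h₃,
      slash_order_₃₂₁ σ τ ρ h₁ h₃, slash_order_₁₂₃ σ τ ρ h₁ h₃]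
    rw [show b * (c * a) = a * (b * c) by ring, show c * (a * b) = a * (b * c) by ring]
    abel

end Jacobi

/-- **Theorem (twisted Lie algebra axioms).**
(a) `{y,x} = -{x,y}·Z_{m,n}` and
(b) `{x,{y,z}} + {y,{z,x}}·Z_{n,m+p} + {z,{x,y}}·Z_{n+m,p} = 0`,
everything transported into the common component `ℤS_{n+m}` resp. `ℤS_{n+m+p}`. -/
theorem twisted_lie (n m p : ℕ) (hn : 1 ≤ n) (hm : 1 ≤ m) (hp : 1 ≤ p)
    (x : Equiv.Perm (Fin n) →₀ ℤ) (y : Equiv.Perm (Fin m) →₀ ℤ)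
    (z : Equiv.Perm (Fin p) →₀ ℤ) :
    (brk y x = - ract (fcast (Nat.add_comm n m) (brk x y)) (zperm m n)) ∧
    (fcast (Nat.add_assoc n m p).symm (brk x (brk y z))
      + fcast (show n + (m + p) = n + m + p by omega)
          (ract (fcast (show m + (p + n) = n + (m + p) by omega) (brk y (brk z x)))
            (zperm n (m + p)))
      + ract (fcast (show p + (n + m) = n + m + p by omega) (brk z (brk x y)))
          (zperm (n + m) p)
      = 0) := by
  exact ⟨brk_antisymm _ x y, brk_jacobi _ _ _ x y z⟩
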